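/- arXiv:q-alg/9606018 — 2 statements merged into one kernel-verified Lean document; each statement's English description precedes it below -/
import Mathlib

section
/- For every k ∈ {0, …, N} there is a polynomial c_k ∈ ℂ[x] such that det Wr(φ_1, …, φ_N, u)(x) = Σ_{k=0}^N c_k(x)·u^{(k)}(x) for every entire function u and every x ∈ ℂ; that is, the Wronskian operator u ↦ det Wr(φ_1, …, φ_N, u) is an ordinary differential operator of order N with polynomial coefficients. -/
open scoped BigOperators

/-- The generalized Airy operator `L₀ u = u^(r) - ∑_{k=1}^{r-2} a_k u^(k) - x·u`. -/
noncomputable def airyOp (r : ℕ) (a : ℕ → ℂ) (u : ℂ → ℂ) : ℂ → ℂ :=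
  fun x => iteratedDeriv r u x
    - (∑ k ∈ Finset.Ico 1 (r - 1), a k * iteratedDeriv k u x) - x * u x

/-- The Wronskian determinant of an `m`-tuple of functions. -/
noncomputable def wrDet (m : ℕ) (g : Fin m → ℂ → ℂ) (x : ℂ) : ℂ :=
  Matrix.det (Matrix.of fun k s : Fin m => iteratedDeriv k.val (g s) x)

/-- The bordered Wronskian determinant `det Wr(g₁, …, g_m, u)`. -/
noncomputable def wrDetB (m : ℕ) (g : Fin m → ℂ → ℂ) (u : ℂ → ℂ) (x : ℂ) : ℂ :=
  wrDet (m + 1) (Fin.snoc g u) x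

/-- The family `φ_{i,j}(x) = γ_i·f_j(x+λ_i) + f_j'(x+λ_i)`, listed in a fixed order
as `φ_1, …, φ_N` with `N = r·n` (index `k` corresponds to `i = k / r`, `j = k % r`). -/
noncomputable def phiFam (r n : ℕ) (f : ℕ → ℂ → ℂ) (lam gam : ℕ → ℂ) :
    Fin (r * n) → ℂ → ℂ :=
  fun k x => gam (k.val / r) * f (k.val % r) (x + lam (k.val / r)) +
    deriv (f (k.val % r)) (x + lam (k.val / r))

/-- The Vandermonde-type product `V = ∏_{i<j} (λ_i - λ_j)`. -/
noncomputable def vand (n : ℕ) (lam : ℕ → ℂ) : ℂ :=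
  ∏ i ∈ Finset.range n, ∏ j ∈ Finset.Ico (i + 1) n, (lam i - lam j)

/-- Derivatives of order at most `r` of a kernel of `airyOp` reduce to those of order below `r`. -/
lemma exists_iteratedDeriv_succ_eq_of_airyOp_eq_zero (r : ℕ) (a : ℕ → ℂ) (hr : 2 ≤ r)
    (l : Fin r) :
    ∃ A : Fin r → Polynomial ℂ, ∀ g : ℂ → ℂ, (∀ x, airyOp r a g x = 0) → ∀ x,
      iteratedDeriv (l + 1) g x = ∑ m, (A m).eval x * iteratedDeriv m g x := by
  by_cases h : l.val + 1 < r
  · refine ⟨Pi.single ⟨l + 1, h⟩ 1, fun g _ x => ?_⟩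
    rw [Finset.sum_eq_single ⟨l + 1, h⟩]
    · simp
    · intro b _ hb
      simp [Pi.single_eq_of_ne hb]
    · simp
  · refine ⟨fun m => (if m.val ∈ Finset.Ico 1 (r - 1) then Polynomial.C (a m) else 0)
      + if m.val = 0 then Polynomial.X else 0, fun g hg x => ?_⟩
    have hl : l.val + 1 = r := by omega
    rw [hl, Fin.sum_univ_eq_sum_range (fun m => Polynomial.eval x
      ((if m ∈ Finset.Ico 1 (r - 1) then Polynomial.C (a m) else 0)
        + if m = 0 then Polynomial.X else 0) * iteratedDeriv m g x) r]
    have hx := hg x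
    simp only [airyOp] at hx
    have hsub : Finset.Ico 1 (r - 1) ⊆ Finset.range r := by
      intro m
      simp only [Finset.mem_Ico, Finset.mem_range]
      omega
    have h₁ : ∑ m ∈ Finset.range r, (if m ∈ Finset.Ico 1 (r - 1) then a m else 0)
        * iteratedDeriv m g x = ∑ m ∈ Finset.Ico 1 (r - 1), a m * iteratedDeriv m g x := by
      rw [← Finset.sum_subset hsub]
      · exact Finset.sum_congr rfl fun m hm => by rw [if_pos hm]
      · intro m _ hm
        rw [if_neg hm, zero_mul]
    have h₂ : ∑ m ∈ Finset.range r, (if m = 0 then x else 0) * iteratedDeriv m g x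
        = x * g x := by
      rw [Finset.sum_eq_single 0]
      · simp
      · intro m _ hm
        rw [if_neg hm, zero_mul]
      · intro h0
        exact absurd (Finset.mem_range.2 (by omega)) h0
    have h₃ : ∀ m, Polynomial.eval x ((if m ∈ Finset.Ico 1 (r - 1) then Polynomial.C (a m) else 0)
        + if m = 0 then Polynomial.X else 0) =
        (if m ∈ Finset.Ico 1 (r - 1) then a m else 0) + if m = 0 then x else 0 := by
      intro m
      rw [Polynomial.eval_add]
      congr 1 <;> split_ifs <;> simp
    simp only [h₃, add_mul, Finset.sum_add_distrib]
    rw [h₁, h₂]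
    linear_combination hx

/-- All derivatives of an entire kernel function of `airyOp` are polynomial combinations of its
derivatives of order below `r`. -/
lemma exists_iteratedDeriv_eq_of_airyOp_eq_zero (r : ℕ) (a : ℕ → ℂ) (hr : 2 ≤ r) (k : ℕ) :
    ∃ P : Fin r → Polynomial ℂ, ∀ g : ℂ → ℂ, Differentiable ℂ g → (∀ x, airyOp r a g x = 0) →
      ∀ x, iteratedDeriv k g x = ∑ l, (P l).eval x * iteratedDeriv l g x := by
  induction k with
  | zero =>
    refine ⟨Pi.single ⟨0, by omega⟩ 1, fun g _ _ x => ?_⟩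
    rw [Finset.sum_eq_single ⟨0, by omega⟩]
    · simp
    · intro b _ hb
      simp [Pi.single_eq_of_ne hb]
    · simp
  | succ k ih =>
    obtain ⟨P, hP⟩ := ih
    choose A hA using exists_iteratedDeriv_succ_eq_of_airyOp_eq_zero r a hr
    refine ⟨fun m => (P m).derivative + ∑ l, P l * A l m, fun g hg hker x => ?_⟩
    have hd : ∀ l, HasDerivAt (iteratedDeriv l g) (iteratedDeriv (l + 1) g x) x := fun l => by
      rw [iteratedDeriv_succ]
      exact ((hg.contDiff (n := ⊤)).differentiable_iteratedDeriv l
        (by exact_mod_cast WithTop.coe_lt_top _) x).hasDerivAt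
    rw [iteratedDeriv_succ, funext (hP g hg hker),
      (HasDerivAt.fun_sum fun (l : Fin r) _ => ((P l).hasDerivAt x).fun_mul (hd l)).deriv]
    simp only [Polynomial.eval_add, Polynomial.eval_finsetSum, Polynomial.eval_mul, add_mul,
      Finset.sum_add_distrib, hA _ g hker, Finset.mul_sum, Finset.sum_mul]
    congr 1
    rw [Finset.sum_comm]
    simp only [mul_assoc]

/-- Derivatives of a shifted first-order combination of an entire function. -/
lemma iteratedDeriv_const_mul_add_deriv_comp_add (g : ℂ → ℂ) (hg : Differentiable ℂ g)
    (c s : ℂ) (k : ℕ) (x : ℂ) :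
    iteratedDeriv k (fun y => c * g (y + s) + deriv g (y + s)) x
      = c * iteratedDeriv k g (x + s) + iteratedDeriv (k + 1) g (x + s) := by
  have h := congrFun (iteratedDeriv_comp_add_const k (fun y => c * g y + deriv g y) s) x
  refine h.trans ?_
  have h₁ : ContDiff ℂ k g := hg.contDiff
  have h₂ : ContDiff ℂ k (deriv g) := hg.deriv.contDiff
  rw [iteratedDeriv_fun_add (contDiff_const.mul h₁).contDiffAt h₂.contDiffAt,
    iteratedDeriv_const_mul_field, iteratedDeriv_succ']

/-- The equivalence sending `(j, i)` to the index `j + r * i`. -/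
def blockIndexEquiv (r n : ℕ) : Fin r × Fin n ≃ Fin (r * n) :=
  ((Equiv.prodComm _ _).trans finProdFinEquiv).trans (finCongr (Nat.mul_comm n r))

lemma blockIndexEquiv_div (r n : ℕ) (p : Fin r × Fin n) :
    (blockIndexEquiv r n p).val / r = p.2 := by
  have hr : 0 < r := p.1.pos
  simp [blockIndexEquiv, Nat.add_mul_div_left _ _ hr, Nat.div_eq_of_lt p.1.isLt]

lemma blockIndexEquiv_mod (r n : ℕ) (p : Fin r × Fin n) :
    (blockIndexEquiv r n p).val % r = p.1 := by
  simp [blockIndexEquiv, Nat.mod_eq_of_lt p.1.isLt]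

theorem statement1 (r n : ℕ) (a : ℕ → ℂ) (f : ℕ → ℂ → ℂ) (lam gam : ℕ → ℂ)
    (hr : 2 ≤ r) (hn : 1 ≤ n)
    (hf : ∀ j < r, Differentiable ℂ (f j))
    (hker : ∀ j < r, ∀ x : ℂ, airyOp r a (f j) x = 0)
    (hwrf : ∀ x : ℂ, wrDet r (fun j => f j.val) x = 1)
    (hlam : ∀ i < n, ∀ j < n, i ≠ j → lam i ≠ lam j) :
    ∃ c : ℕ → Polynomial ℂ, ∀ u : ℂ → ℂ, Differentiable ℂ u → ∀ x : ℂ,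
      wrDetB (r * n) (phiFam r n f lam gam) u x
        = ∑ k ∈ Finset.range (r * n + 1), (c k).eval x * iteratedDeriv k u x := by
  choose P hP using exists_iteratedDeriv_eq_of_airyOp_eq_zero r a hr
  let e := blockIndexEquiv r n
  let Q : ℕ → Fin r × Fin n → Polynomial ℂ := fun k p =>
    (Polynomial.C (gam p.2) * P k p.1 + P (k + 1) p.1).comp
      (Polynomial.X + Polynomial.C (lam p.2))
  let D : Fin (r * n + 1) → Polynomial ℂ := fun k =>
    Matrix.det (Matrix.of fun p q => Q (k.succAbove (e p)) q)
  let c : Fin (r * n + 1) → Polynomial ℂ := fun k => (-1) ^ (k.val + r * n) * D k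
  let B : ℂ → Fin n → Matrix (Fin r) (Fin r) ℂ := fun x i =>
    Matrix.of fun l j => iteratedDeriv l.val (f j) (x + lam i)
  have hphi : ∀ k x q, iteratedDeriv k (phiFam r n f lam gam (e q)) x
      = ∑ p, (Q k p).eval x * Matrix.blockDiagonal (B x) p q := by
    rintro k x ⟨j, i⟩
    have hfun : phiFam r n f lam gam (e (j, i)) =
        fun y => gam i * f j (y + lam i) + deriv (f j) (y + lam i) := by
      funext y
      simp only [phiFam, e, blockIndexEquiv_div, blockIndexEquiv_mod]
    rw [hfun, iteratedDeriv_const_mul_add_deriv_comp_add _ (hf j j.isLt),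
      hP k _ (hf j j.isLt) (hker j j.isLt), hP (k + 1) _ (hf j j.isLt) (hker j j.isLt),
      Finset.mul_sum, ← Finset.sum_add_distrib, Fintype.sum_prod_type]
    refine Finset.sum_congr rfl fun l _ => ?_
    rw [Finset.sum_eq_single i]
    · simp [Q, B]
      ring
    · intro i' _ hi
      simp [Matrix.blockDiagonal_apply, hi]
    · simp
  have hminor : ∀ (k : Fin (r * n + 1)) x, Matrix.det (Matrix.of fun s t : Fin (r * n) =>
      iteratedDeriv (k.succAbove s) (phiFam r n f lam gam t) x) = (D k).eval x := by
    intro k x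
    have hmul : (Matrix.of fun s t : Fin (r * n) =>
        iteratedDeriv (k.succAbove s) (phiFam r n f lam gam t) x).submatrix e e
        = (Polynomial.evalRingHom x).mapMatrix
          (Matrix.of fun p q => Q (k.succAbove (e p)) q) * Matrix.blockDiagonal (B x) := by
      ext p q
      simp [Matrix.mul_apply, hphi]
    have hdet : (Matrix.blockDiagonal (B x)).det = 1 := by
      rw [Matrix.det_blockDiagonal]
      exact Finset.prod_eq_one fun i _ => hwrf (x + lam i)
    rw [← Matrix.det_submatrix_equiv_self e, hmul, Matrix.det_mul, hdet, mul_one,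
      ← RingHom.map_det]
    rfl
  refine ⟨fun k => if h : k < r * n + 1 then c ⟨k, h⟩ else 0, fun u _ x => ?_⟩
  rw [Finset.sum_range, wrDetB, wrDet, Matrix.det_succ_column _ (Fin.last _)]
  refine Finset.sum_congr rfl fun k _ => ?_
  have hsub : (Matrix.of fun k s : Fin (r * n + 1) => iteratedDeriv k.val
      ((Fin.snoc (phiFam r n f lam gam) u : Fin (r * n + 1) → ℂ → ℂ) s) x).submatrix k.succAbove
        (Fin.last _).succAbove = Matrix.of fun s t : Fin (r * n) =>
      iteratedDeriv (k.succAbove s) (phiFam r n f lam gam t) x := by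
    ext s t
    simp
  have hk : k.val < r * n + 1 := k.isLt
  rw [hsub, hminor]
  simp only [dif_pos hk]
  simp [c]
  ring
end

section
/- The function x ↦ det Wr(φ_1, …, φ_N)(x) is a polynomial in x of degree exactly n whose leading coefficient equals V^r or −V^r; equivalently, for a suitable sign ε ∈ {1, −1}, the function ε·det Wr(φ_1, …, φ_N)(x)/V^r is a monic polynomial of degree n in x. -/
open scoped BigOperators

open Polynomial in
/-- The linear functional `X ^ k ↦ f^(k)(y)`, i.e. `q ↦ (q(D) f)(y)`. -/
noncomputable def jet (f : ℂ → ℂ) (y : ℂ) : ℂ[X] →ₗ[ℂ] ℂ :=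
  Polynomial.lsum fun k => iteratedDeriv k f y • LinearMap.id

open Polynomial in
theorem jet_monomial (f : ℂ → ℂ) (y c : ℂ) (k : ℕ) :
    jet f y (monomial k c) = c * iteratedDeriv k f y := by
  simp [jet, Polynomial.lsum_apply, Polynomial.sum_monomial_index, mul_comm]

open Polynomial in
theorem jet_X_pow (f : ℂ → ℂ) (y : ℂ) (k : ℕ) : jet f y (X ^ k) = iteratedDeriv k f y := by
  rw [X_pow_eq_monomial, jet_monomial, one_mul]

theorem iteratedDeriv_of_airyOp_eq_zero {r : ℕ} {a : ℕ → ℂ} {f : ℂ → ℂ}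
    (hf : Differentiable ℂ f) (hker : ∀ x, airyOp r a f x = 0) (k : ℕ) (y : ℂ) :
    iteratedDeriv (r + k) f y = ∑ j ∈ Finset.Ico 1 (r - 1), a j * iteratedDeriv (j + k) f y
      + y * iteratedDeriv k f y + k * iteratedDeriv (k - 1) f y := by
  have hd : ∀ k y, HasDerivAt (iteratedDeriv k f) (iteratedDeriv (k + 1) f y) y := fun k y => by
    rw [iteratedDeriv_succ]
    exact (hf.contDiff (n := ⊤).differentiable_iteratedDeriv k
      (by exact_mod_cast WithTop.coe_lt_top _) y).hasDerivAt
  induction k generalizing y with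
  | zero =>
    have := hker y
    simp only [airyOp] at this
    simp only [add_zero, iteratedDeriv_zero, Nat.cast_zero, zero_mul]
    linear_combination this
  | succ k ih =>
    have h1 := hd (r + k) y
    rw [funext ih] at h1
    have h2 := ((HasDerivAt.fun_sum (u := Finset.Ico 1 (r - 1))
      (fun j _ => (hd (j + k) y).const_mul (a j))).add
        ((hasDerivAt_id y).mul (hd k y))).add ((hd (k - 1) y).const_mul (k : ℂ))
    have h3 := h1.unique h2
    rw [← add_assoc, h3]
    have h4 : (k : ℂ) * iteratedDeriv (k - 1 + 1) f y = k * iteratedDeriv k f y := by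
      rcases k with _ | k <;> simp
    simp only [h4, id, one_mul, Nat.add_sub_cancel, Nat.cast_add, Nat.cast_one, add_assoc]
    ring

open Polynomial in
/-- The symbol `X ^ r - ∑ a_k X ^ k - x` of the generalized Airy operator at the point `x`. -/
noncomputable def airySymbol (r : ℕ) (a : ℕ → ℂ) (x : ℂ) : ℂ[X] :=
  X ^ r - (∑ k ∈ Finset.Ico 1 (r - 1), C (a k) * X ^ k + C x)

open Polynomial in
/-- The operator on symbols dual to `airyOp`: `jet u x (airyAdj r a x q) = jet (airyOp r a u) x q`
for entire `u`. -/
noncomputable def airyAdj (r : ℕ) (a : ℕ → ℂ) (x : ℂ) : ℂ[X] →ₗ[ℂ] ℂ[X] :=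
  LinearMap.mulLeft ℂ (airySymbol r a x) - derivative

open Polynomial in
theorem airyAdj_apply (r : ℕ) (a : ℕ → ℂ) (x : ℂ) (q : ℂ[X]) :
    airyAdj r a x q = airySymbol r a x * q - derivative q := rfl

open Polynomial in
theorem airyAdj_X_mul (r : ℕ) (a : ℕ → ℂ) (x : ℂ) (q : ℂ[X]) :
    airyAdj r a x (X * q) = X * airyAdj r a x q - q := by
  simp only [airyAdj_apply, derivative_mul, derivative_X]
  ring

open Polynomial in
theorem airySymbol_monic {r : ℕ} (hr : 2 ≤ r) (a : ℕ → ℂ) (x : ℂ) :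
    (airySymbol r a x).Monic ∧ (airySymbol r a x).natDegree = r := by
  have h : (∑ k ∈ Finset.Ico 1 (r - 1), C (a k) * X ^ k + C x).degree < (r : WithBot ℕ) := by
    refine (degree_add_le _ _).trans_lt (max_lt ?_ ?_)
    · refine (degree_sum_le _ _).trans_lt ((Finset.sup_lt_iff (WithBot.bot_lt_coe r)).2 ?_)
      intro k hk
      refine (degree_C_mul_X_pow_le _ _).trans_lt ?_
      rw [Finset.mem_Ico] at hk
      exact WithBot.coe_lt_coe.2 (hk.2.trans_le (Nat.sub_le r 1))
    · exact degree_C_le.trans_lt (by exact_mod_cast (by omega : 0 < r))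
  have h' : (∑ k ∈ Finset.Ico 1 (r - 1), C (a k) * X ^ k + C x).degree
      < (X ^ r : ℂ[X]).degree := by rwa [degree_X_pow]
  exact ⟨(monic_X_pow r).sub_of_left h', by
    rw [airySymbol, natDegree_eq_of_degree_eq (degree_sub_eq_left_of_degree_lt h'),
      natDegree_X_pow]⟩

open Polynomial in
theorem airyAdj_monic {r : ℕ} (hr : 2 ≤ r) (a : ℕ → ℂ) (x : ℂ) {q : ℂ[X]} (hq : q.Monic) :
    (airyAdj r a x q).Monic ∧ (airyAdj r a x q).natDegree = r + q.natDegree := by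
  obtain ⟨hm, hd⟩ := airySymbol_monic hr a x
  have hnd := hm.natDegree_mul hq
  have hlt : (derivative q).degree < (airySymbol r a x * q).degree := by
    refine (degree_derivative_lt hq.ne_zero).trans_le ?_
    rw [degree_eq_natDegree hq.ne_zero, degree_eq_natDegree (hm.mul hq).ne_zero, hnd]
    exact_mod_cast Nat.le_add_left _ _
  exact ⟨(hm.mul hq).sub_of_left hlt, by
    rw [airyAdj_apply, natDegree_eq_of_degree_eq (degree_sub_eq_left_of_degree_lt hlt), hnd, hd]⟩

open Polynomial in
theorem iterate_airyAdj_monic {r : ℕ} (hr : 2 ≤ r) (a : ℕ → ℂ) (x : ℂ) (l s : ℕ) :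
    (((airyAdj r a x)^[s]) (X ^ l)).Monic ∧
      (((airyAdj r a x)^[s]) (X ^ l)).natDegree = l + r * s := by
  induction s with
  | zero => simp [monic_X_pow]
  | succ s ih =>
    rw [Function.iterate_succ_apply']
    obtain ⟨h1, h2⟩ := airyAdj_monic hr a x ih.1
    refine ⟨h1, ?_⟩
    rw [h2, ih.2]
    ring

open Polynomial in
theorem jet_airyAdj {r : ℕ} {a : ℕ → ℂ} {f : ℂ → ℂ} (hf : Differentiable ℂ f)
    (hker : ∀ x, airyOp r a f x = 0) (x μ : ℂ) (q : ℂ[X]) :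
    jet f (x + μ) (airyAdj r a x q) = μ * jet f (x + μ) q := by
  induction q using Polynomial.induction_on' with
  | add p q hp hq => simp only [map_add, hp, hq, mul_add]
  | monomial k c =>
    have h := iteratedDeriv_of_airyOp_eq_zero hf hker k (x + μ)
    simp only [airyAdj_apply, airySymbol, sub_mul, add_mul, Finset.sum_mul, map_sub, map_add,
      map_sum, mul_assoc, X_pow_mul_monomial, C_mul_monomial, derivative_monomial, jet_monomial]
    rw [Nat.add_comm k r, h]
    simp only [mul_add, Finset.mul_sum, Nat.add_comm k]
    rw [Finset.sum_congr rfl fun j _ => show c * (a j * iteratedDeriv (j + k) f (x + μ))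
      = a j * (c * iteratedDeriv (j + k) f (x + μ)) by ring]
    ring

open Polynomial in
theorem jet_iterate_airyAdj {r : ℕ} {a : ℕ → ℂ} {f : ℂ → ℂ} (hf : Differentiable ℂ f)
    (hker : ∀ x, airyOp r a f x = 0) (x μ γ : ℂ) (q : ℂ[X]) (s : ℕ) :
    jet f (x + μ) (((airyAdj r a x)^[s]) q) = μ ^ s * jet f (x + μ) q ∧
    jet f (x + μ) ((C γ + X) * ((airyAdj r a x)^[s]) q) =
      μ ^ s * jet f (x + μ) ((C γ + X) * q) + s * μ ^ (s - 1) * jet f (x + μ) q := by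
  induction s with
  | zero => simp
  | succ s ih =>
    simp only [Function.iterate_succ_apply']
    set p := ((airyAdj r a x)^[s]) q
    refine ⟨by rw [jet_airyAdj hf hker, ih.1, pow_succ]; ring, ?_⟩
    have h : (C γ + X) * airyAdj r a x p = airyAdj r a x ((C γ + X) * p) + p := by
      rw [add_mul, add_mul, map_add, airyAdj_X_mul, ← smul_eq_C_mul, ← smul_eq_C_mul, map_smul]
      ring
    rw [h, map_add, jet_airyAdj hf hker, ih.1, ih.2]
    rcases s with _ | s
    · simp
    · simp only [Nat.add_sub_cancel, Nat.cast_add, Nat.cast_one]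
      ring

open Polynomial in
theorem coeff_prod_sum_of_natDegree_le {ι R : Type*} [CommSemiring R] (t : Finset ι)
    (g : ι → R[X]) (d : ι → ℕ) (h : ∀ i ∈ t, (g i).natDegree ≤ d i) :
    (∏ i ∈ t, g i).coeff (∑ i ∈ t, d i) = ∏ i ∈ t, (g i).coeff (d i) := by
  classical
  induction t using Finset.induction_on with
  | empty => simp
  | insert i t hi ih =>
    have ht : ∀ j ∈ t, (g j).natDegree ≤ d j := fun j hj => h j (Finset.mem_insert_of_mem hj)
    rw [Finset.prod_insert hi, Finset.sum_insert hi, Finset.prod_insert hi,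
      coeff_mul_add_eq_of_natDegree_le (h i (Finset.mem_insert_self _ _))
        ((natDegree_prod_le _ _).trans (Finset.sum_le_sum ht)), ih ht]

open Polynomial in
theorem natDegree_det_le_sum_of_rows {ι R : Type*} [CommRing R] [Fintype ι] [DecidableEq ι]
    (M : Matrix ι ι R[X]) (d : ι → ℕ) (h : ∀ i j, (M i j).natDegree ≤ d i) :
    M.det.natDegree ≤ ∑ i, d i := by
  rw [← Matrix.det_transpose, Matrix.det_apply]
  refine natDegree_sum_le_of_forall_le _ _ fun σ _ => ?_
  refine (natDegree_smul_le _ _).trans ((natDegree_prod_le _ _).trans ?_)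
  exact Finset.sum_le_sum fun i _ => h _ _

open Polynomial in
theorem coeff_det_sum_of_rows {ι R : Type*} [CommRing R] [Fintype ι] [DecidableEq ι]
    (M : Matrix ι ι R[X]) (d : ι → ℕ) (h : ∀ i j, (M i j).natDegree ≤ d i) :
    M.det.coeff (∑ i, d i) = (Matrix.of fun i j => (M i j).coeff (d i)).det := by
  rw [← Matrix.det_transpose, ← Matrix.det_transpose (Matrix.of _), Matrix.det_apply,
    Matrix.det_apply, finsetSum_coeff]
  refine Finset.sum_congr rfl fun σ _ => ?_
  rw [coeff_smul]
  exact congrArg _ (coeff_prod_sum_of_natDegree_le Finset.univ (fun i => M i (σ i)) d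
    fun i _ => h _ _)

open Polynomial in
/-- The companion matrix of the generalized Airy equation at `X + μ`. -/
noncomputable def airyCompanion (r : ℕ) (a : ℕ → ℂ) (μ : ℂ) (l m : Fin r) : ℂ[X] :=
  if l.val + 1 < r then C (if m.val = l.val + 1 then 1 else 0)
  else (if m.val = 0 then X + C μ else 0) + C (if m.val ∈ Finset.Ico 1 (r - 1) then a m else 0)

theorem sum_airyCompanion_mul {r : ℕ} {a : ℕ → ℂ} {f : ℂ → ℂ} (hf : Differentiable ℂ f)
    (hker : ∀ x, airyOp r a f x = 0) (x μ : ℂ) (l : Fin r) :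
    ∑ m, (airyCompanion r a μ l m).eval x * iteratedDeriv m.val f (x + μ)
      = iteratedDeriv (l.val + 1) f (x + μ) := by
  by_cases hl : l.val + 1 < r
  · rw [Finset.sum_eq_single (⟨l.val + 1, hl⟩ : Fin r)]
    · simp [airyCompanion, hl]
    · intro m _ hm
      have : m.val ≠ l.val + 1 := fun h => hm (Fin.ext h)
      simp [airyCompanion, hl, this]
    · simp
  · have hl' : l.val + 1 = r := by omega
    have h := iteratedDeriv_of_airyOp_eq_zero hf hker 0 (x + μ)
    simp only [add_zero, Nat.cast_zero, zero_mul] at h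
    simp only [airyCompanion, hl, if_false]
    rw [hl', h, Fin.sum_univ_eq_sum_range (fun m => Polynomial.eval x
        ((if m = 0 then Polynomial.X + Polynomial.C μ else 0)
          + Polynomial.C (if m ∈ Finset.Ico 1 (r - 1) then a m else 0))
        * iteratedDeriv m f (x + μ)) r]
    simp only [Polynomial.eval_add, Polynomial.eval_C, add_mul,
      Finset.sum_add_distrib]
    rw [add_comm]
    congr 1
    · rw [← Finset.sum_filter_add_sum_filter_not (Finset.range r) (· ∈ Finset.Ico 1 (r - 1))]
      rw [Finset.sum_eq_zero (s := Finset.filter (· ∉ Finset.Ico 1 (r - 1)) _), add_zero]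
      · have : Finset.filter (· ∈ Finset.Ico 1 (r - 1)) (Finset.range r)
            = Finset.Ico 1 (r - 1) := by
          ext m
          simp only [Finset.mem_filter, Finset.mem_range, Finset.mem_Ico]
          omega
        rw [this]
        exact Finset.sum_congr rfl fun m hm => by rw [if_pos hm]
      · intro m hm
        rw [if_neg (Finset.mem_filter.1 hm).2, zero_mul]
    · rw [Finset.sum_eq_single 0]
      · simp
        ring
      · intro m _ hm
        simp [hm]
      · intro h0
        exact absurd (Finset.mem_range.2 (by omega)) h0

open Polynomial in
/-- The polynomial matrix expressing the row-reduced Wronskian matrix of the `φ_{i,j}` through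
the derivatives of order `< r` of the `f_j(· + λ_i)`. -/
noncomputable def airyMatrix (r n : ℕ) (a lam gam : ℕ → ℂ) :
    Matrix (Fin r × Fin n) (Fin r × Fin n) ℂ[X] :=
  Matrix.of fun p q =>
    C (lam q.2 ^ p.2.val) * airyCompanion r a (lam q.2) p.1 q.1 +
      C (if p.1 = q.1 then lam q.2 ^ p.2.val * gam q.2 + p.2.val * lam q.2 ^ (p.2.val - 1) else 0)

/-- The enumeration `(l, s) ↦ l + r * s`. -/
def prodEquiv (r n : ℕ) : Fin r × Fin n ≃ Fin (r * n) :=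
  ((Equiv.prodComm _ _).trans finProdFinEquiv).trans (finCongr (Nat.mul_comm n r))

theorem prodEquiv_val (r n : ℕ) (p : Fin r × Fin n) :
    (prodEquiv r n p).val = p.1.val + r * p.2.val := rfl

theorem prodEquiv_mod (r n : ℕ) (p : Fin r × Fin n) : (prodEquiv r n p).val % r = p.1.val := by
  rw [prodEquiv_val, Nat.add_mul_mod_self_left, Nat.mod_eq_of_lt p.1.2]

theorem prodEquiv_div (r n : ℕ) (p : Fin r × Fin n) : (prodEquiv r n p).val / r = p.2.val := by
  have := p.1.pos
  rw [prodEquiv_val, Nat.add_mul_div_left _ _ this, Nat.div_eq_of_lt p.1.2, zero_add]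

open Polynomial in
theorem iteratedDeriv_add_deriv_comp_add {f : ℂ → ℂ} (hf : Differentiable ℂ f) (γ μ x : ℂ)
    (k : ℕ) :
    iteratedDeriv k (fun x => γ * f (x + μ) + deriv f (x + μ)) x
      = jet f (x + μ) ((C γ + X) * X ^ k) := by
  rw [iteratedDeriv_comp_add_const k (fun z => γ * f z + deriv f z) μ]
  have h1 : ContDiff ℂ k f := hf.contDiff
  have h2 : ContDiff ℂ k (deriv f) := hf.deriv.contDiff
  beta_reduce
  rw [iteratedDeriv_fun_add (contDiff_const.mul h1).contDiffAt h2.contDiffAt,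
    iteratedDeriv_const_mul_field, ← iteratedDeriv_succ', add_mul, map_add, ← smul_eq_C_mul,
    map_smul, ← pow_succ', jet_X_pow, jet_X_pow, smul_eq_mul]

open Polynomial in
theorem wrDet_phiFam_eq_eval {r n : ℕ} {a : ℕ → ℂ} {f : ℕ → ℂ → ℂ} {lam gam : ℕ → ℂ}
    (hr : 2 ≤ r) (hf : ∀ j < r, Differentiable ℂ (f j))
    (hker : ∀ j < r, ∀ x : ℂ, airyOp r a (f j) x = 0)
    (hwrf : ∀ x : ℂ, wrDet r (fun j => f j.val) x = 1) (x : ℂ) :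
    wrDet (r * n) (phiFam r n f lam gam) x = (airyMatrix r n a lam gam).det.eval x := by
  let q : Fin (r * n) → ℂ[X] := fun k => ((airyAdj r a x)^[k.val / r]) (X ^ (k.val % r))
  have hq : ∀ k, (q k).Monic ∧ (q k).natDegree = k.val := fun k => by
    have := iterate_airyAdj_monic hr a x (k.val % r) (k.val / r)
    rwa [Nat.mod_add_div] at this
  have hU := Matrix.det_matrixOfPolynomials q (fun k => (hq k).2) (fun k => (hq k).1)
  let J : Fin (r * n) → ℂ[X] →ₗ[ℂ] ℂ := fun c =>
    jet (f (c.val % r)) (x + lam (c.val / r)) ∘ₗ LinearMap.mulLeft ℂ (C (gam (c.val / r)) + X)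
  have hlt : ∀ c : Fin (r * n), c.val % r < r := fun c => Nat.mod_lt _ (by omega)
  have hred : (Matrix.of fun k c : Fin (r * n) => J c (q k)) =
      (Matrix.of fun i j : Fin (r * n) => (q j).coeff i).transpose *
        Matrix.of fun k c : Fin (r * n) => iteratedDeriv k.val (phiFam r n f lam gam c) x := by
    ext k c
    rw [Matrix.mul_apply, Matrix.of_apply,
      (q k).as_sum_range' (r * n) (by rw [(hq k).2]; exact k.2), map_sum,
      ← Fin.sum_univ_eq_sum_range (fun i => J c (monomial i ((q k).coeff i)))]
    refine Finset.sum_congr rfl fun i _ => ?_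
    rw [Matrix.transpose_apply, Matrix.of_apply, Matrix.of_apply,
      show iteratedDeriv i.val (phiFam r n f lam gam c) x = J c (X ^ i.val) from
        iteratedDeriv_add_deriv_comp_add (hf _ (hlt c)) _ _ _ _,
      ← C_mul_X_pow_eq_monomial, ← smul_eq_C_mul, map_smul, smul_eq_mul]
  have hfac : (Matrix.of fun k c : Fin (r * n) => J c (q k)).submatrix
      (prodEquiv r n) (prodEquiv r n) = (airyMatrix r n a lam gam).map (eval x) *
        Matrix.blockDiagonal fun i : Fin n =>
          Matrix.of fun k j : Fin r => iteratedDeriv k.val (f j.val) (x + lam i) := by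
    ext p c
    have h := sum_airyCompanion_mul (hf _ c.1.2) (hker _ c.1.2) x (lam c.2) p.1
    simp only [Matrix.submatrix_apply, Matrix.of_apply, J, q, prodEquiv_mod, prodEquiv_div,
      LinearMap.comp_apply, LinearMap.mulLeft_apply]
    rw [(jet_iterate_airyAdj (hf _ c.1.2) (hker _ c.1.2) x _ _ _ _).2, Matrix.mul_apply,
      Fintype.sum_prod_type]
    simp only [Matrix.blockDiagonal_apply, Matrix.map_apply, mul_ite, mul_zero,
      Finset.sum_ite_eq', Finset.mem_univ, if_true, airyMatrix, Matrix.of_apply, eval_add,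
      eval_mul, eval_C, add_mul, Finset.sum_add_distrib, ite_mul, zero_mul, Finset.sum_ite_eq,
      mul_assoc]
    rw [← Finset.mul_sum, h, map_add, ← smul_eq_C_mul, map_smul, ← pow_succ', jet_X_pow, jet_X_pow,
      smul_eq_mul]
    ring
  have hdet := congrArg Matrix.det hfac
  rw [Matrix.det_submatrix_equiv_self, hred, Matrix.det_mul, Matrix.det_transpose, hU, one_mul,
    Matrix.det_mul, Matrix.det_blockDiagonal,
    Finset.prod_eq_one (f := fun i : Fin n => Matrix.det (Matrix.of fun k j : Fin r =>
      iteratedDeriv k.val (f j.val) (x + lam i))) fun i _ => hwrf (x + lam i), mul_one] at hdet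
  rw [wrDet, hdet, ← coe_evalRingHom, RingHom.map_det]
  rfl

theorem finRotate_val (r : ℕ) (l : Fin r) :
    (finRotate r l).val = if l.val + 1 < r then l.val + 1 else 0 := by
  obtain _ | r := r
  · exact l.elim0
  split_ifs with h
  · exact coe_finRotate_of_ne_last fun h' => by simp [h'] at h
  · rw [show l = Fin.last r from Fin.ext (by simp; omega), finRotate_last]
    rfl

open Polynomial in
theorem natDegree_airyMatrix_le (r n : ℕ) (a lam gam : ℕ → ℂ) (p q : Fin r × Fin n) :
    (airyMatrix r n a lam gam p q).natDegree ≤ if p.1.val + 1 < r then 0 else 1 := by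
  simp only [airyMatrix, airyCompanion, Matrix.of_apply]
  split_ifs <;> compute_degree <;> exact zero_le_one

open Polynomial in
theorem coeff_airyMatrix (r n : ℕ) (a lam gam : ℕ → ℂ) (p q : Fin r × Fin n) :
    (airyMatrix r n a lam gam p q).coeff (if p.1.val + 1 < r then 0 else 1) =
      (if q.1 = finRotate r p.1 then lam q.2 ^ p.2.val else 0) +
      if p.1.val + 1 < r ∧ p.1 = q.1 then
        lam q.2 ^ p.2.val * gam q.2 + p.2.val * lam q.2 ^ (p.2.val - 1) else 0 := by
  simp only [Fin.ext_iff (a := q.1) (b := finRotate r p.1), finRotate_val, airyMatrix,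
    airyCompanion, Matrix.of_apply, coeff_add, coeff_C_mul]
  by_cases h : p.1.val + 1 < r
  · by_cases h0 : q.1.val = p.1.val + 1 <;> simp [h, h0]
  · by_cases h0 : q.1.val = 0 <;> simp [h, h0]

theorem det_rotated_blockTriangular {R : Type*} [CommRing R] (r n : ℕ)
    (W G : Matrix (Fin n) (Fin n) R) :
    (Matrix.of fun p q : Fin r × Fin n => (if q.1 = finRotate r p.1 then W p.2 q.2 else 0) +
      if p.1.val + 1 < r ∧ p.1 = q.1 then G p.2 q.2 else 0).det = W.det ^ r ∨
    (Matrix.of fun p q : Fin r × Fin n => (if q.1 = finRotate r p.1 then W p.2 q.2 else 0) +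
      if p.1.val + 1 < r ∧ p.1 = q.1 then G p.2 q.2 else 0).det = -W.det ^ r := by
  set B : Matrix (Fin r × Fin n) (Fin r × Fin n) R :=
    Matrix.of fun p q => (if q.1 = finRotate r p.1 then W p.2 q.2 else 0) +
      if p.1.val + 1 < r ∧ p.1 = q.1 then G p.2 q.2 else 0 with hB
  let σ : Equiv.Perm (Fin r × Fin n) := (finRotate r).prodCongr (Equiv.refl _)
  let b : Fin r × Fin n → (Fin r)ᵒᵈ := fun p => OrderDual.toDual (finRotate r p.1)
  have happ : ∀ p q, (B.submatrix id σ) p q = (if q.1 = p.1 then W p.2 q.2 else 0) +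
      if p.1.val + 1 < r ∧ p.1 = finRotate r q.1 then G p.2 q.2 else 0 := fun p q => by
    simp [hB, σ]
  have htri : (B.submatrix id σ).BlockTriangular b := fun p q hpq => by
    have hpq' : (finRotate r p.1).val < (finRotate r q.1).val := hpq
    rw [happ, if_neg, if_neg, add_zero]
    · rintro ⟨h1, h2⟩
      rw [← h2, finRotate_val, if_pos h1] at hpq'
      omega
    · rintro h
      rw [h] at hpq'
      exact lt_irrefl _ hpq'
  have hblock : ∀ k, ((B.submatrix id σ).toSquareBlock b k).det = W.det := fun k => by
    let l : Fin r := (finRotate r).symm (OrderDual.ofDual k)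
    have hl : ∀ p : Fin r × Fin n, b p = k ↔ p.1 = l := fun p => by
      simp only [l, Equiv.eq_symm_apply]
      rfl
    let e : Fin n ≃ {p // b p = k} :=
      { toFun := fun s => ⟨(l, s), (hl _).2 rfl⟩
        invFun := fun p => p.1.2
        left_inv := fun _ => rfl
        right_inv := fun p => Subtype.ext (Prod.ext ((hl _).1 p.2).symm rfl) }
    rw [← Matrix.det_submatrix_equiv_self e]
    congr 1
    ext s t
    have hne : ¬ (l.val + 1 < r ∧ l = finRotate r l) := by
      rintro ⟨h1, h2⟩
      have := congrArg Fin.val h2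
      rw [finRotate_val, if_pos h1] at this
      omega
    change (B.submatrix id σ) (l, s) (l, t) = _
    rw [happ, if_pos rfl, if_neg hne, add_zero]
  have hdet := Matrix.det_permute' σ B
  rw [htri.det_fintype, Finset.prod_congr rfl fun k _ => hblock k, Finset.prod_const,
    Finset.card_univ, Fintype.card_orderDual, Fintype.card_fin] at hdet
  rcases Int.units_eq_one_or (Equiv.Perm.sign σ) with h | h <;> rw [h] at hdet
  · left
    simpa using hdet.symm
  · right
    rw [hdet]
    simp

theorem det_vandermonde_eq_vand_or_neg (n : ℕ) (lam : ℕ → ℂ) :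
    (Matrix.of fun s i : Fin n => lam i ^ s.val).det = vand n lam ∨
      (Matrix.of fun s i : Fin n => lam i ^ s.val).det = -vand n lam := by
  have h : (Matrix.of fun s i : Fin n => lam i ^ s.val)
      = (Matrix.vandermonde fun i : Fin n => lam i).transpose := rfl
  rw [← sq_eq_sq_iff_eq_or_eq_neg, h, Matrix.det_transpose, Matrix.det_vandermonde, vand,
    ← Fin.prod_univ_eq_prod_range (fun i => ∏ j ∈ Finset.Ico (i + 1) n, (lam i - lam j)) n]
  simp only [← Finset.prod_pow]
  refine Finset.prod_congr rfl fun i _ => ?_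
  have hmap := Finset.prod_map (Finset.Ioi i) Fin.valEmbedding fun j => (lam j - lam i) ^ 2
  simp only [Fin.valEmbedding_apply] at hmap
  rw [← hmap, Fin.map_valEmbedding_Ioi]
  refine Finset.prod_congr ?_ fun j _ => by ring
  ext j
  simp only [Finset.mem_Ioo, Finset.mem_Ico]
  omega

theorem vand_ne_zero {n : ℕ} {lam : ℕ → ℂ}
    (hlam : ∀ i < n, ∀ j < n, i ≠ j → lam i ≠ lam j) : vand n lam ≠ 0 := by
  refine Finset.prod_ne_zero_iff.2 fun i hi => Finset.prod_ne_zero_iff.2 fun j hj => ?_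
  rw [Finset.mem_range] at hi
  rw [Finset.mem_Ico] at hj
  exact sub_ne_zero.2 (hlam i hi j hj.2 (by omega))

theorem neg_pow_eq_self_or_neg {R : Type*} [Ring R] (x : R) (r : ℕ) :
    (-x) ^ r = x ^ r ∨ (-x) ^ r = -x ^ r :=
  (Nat.even_or_odd r).imp (fun h => h.neg_pow x) fun h => h.neg_pow x

theorem statement2 (r n : ℕ) (a : ℕ → ℂ) (f : ℕ → ℂ → ℂ) (lam gam : ℕ → ℂ)
    (hr : 2 ≤ r) (hn : 1 ≤ n)
    (hf : ∀ j < r, Differentiable ℂ (f j))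
    (hker : ∀ j < r, ∀ x : ℂ, airyOp r a (f j) x = 0)
    (hwrf : ∀ x : ℂ, wrDet r (fun j => f j.val) x = 1)
    (hlam : ∀ i < n, ∀ j < n, i ≠ j → lam i ≠ lam j) :
    ∃ p : Polynomial ℂ,
      (∀ x : ℂ, p.eval x = wrDet (r * n) (phiFam r n f lam gam) x) ∧
      p.degree = (n : WithBot ℕ) ∧
      (p.leadingCoeff = vand n lam ^ r ∨ p.leadingCoeff = -(vand n lam ^ r)) := by
  set p := (airyMatrix r n a lam gam).det with hp
  let d : Fin r × Fin n → ℕ := fun q => if q.1.val + 1 < r then 0 else 1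
  have hd : ∑ q, d q = n := by
    rw [Fintype.sum_prod_type, Finset.sum_eq_single (⟨r - 1, by omega⟩ : Fin r)]
    · simp only [d, if_neg (show ¬ r - 1 + 1 < r by omega)]
      simp
    · intro l _ hl
      have : l.val ≠ r - 1 := fun h => hl (Fin.ext h)
      simp [d, show l.val + 1 < r by omega]
    · simp
  have hle : p.natDegree ≤ n := by
    rw [← hd]
    exact natDegree_det_le_sum_of_rows _ d (natDegree_airyMatrix_le r n a lam gam)
  have hcoeff : p.coeff n = vand n lam ^ r ∨ p.coeff n = -(vand n lam ^ r) := by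
    have h := coeff_det_sum_of_rows _ d (natDegree_airyMatrix_le r n a lam gam)
    simp only [d, coeff_airyMatrix] at h
    rw [← hp, show (∑ q : Fin r × Fin n, if q.1.val + 1 < r then 0 else 1) = n from hd] at h
    have hB := det_rotated_blockTriangular r n (Matrix.of fun s i : Fin n => lam i ^ s.val)
      (Matrix.of fun s i : Fin n => lam i ^ s.val * gam i + s.val * lam i ^ (s.val - 1))
    simp only [Matrix.of_apply] at hB
    rw [← h] at hB
    rcases det_vandermonde_eq_vand_or_neg n lam with hV | hV <;> rw [hV] at hB
    · exact hB
    · rcases neg_pow_eq_self_or_neg (vand n lam) r with h' | h' <;> rw [h'] at hB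
      · exact hB
      · rwa [neg_neg, or_comm] at hB
  have hne : p.coeff n ≠ 0 := by
    have h := pow_ne_zero r (vand_ne_zero hlam)
    rcases hcoeff with h' | h' <;> rw [h']
    · exact h
    · exact neg_ne_zero.2 h
  have hnat : p.natDegree = n := le_antisymm hle (Polynomial.le_natDegree_of_ne_zero hne)
  refine ⟨p, fun x => (wrDet_phiFam_eq_eval hr hf hker hwrf x).symm, ?_, ?_⟩
  · rw [Polynomial.degree_eq_natDegree fun h => hne (by simp [h]), hnat]
  · rwa [Polynomial.leadingCoeff, hnat]
end
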